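/- One has rhobar_{p} = max{rho_{p}, rho_{Delta p} - 1}, and the minimal function f^{rhobar_{p}}_{p} belongs to F(p, rhobar_{p}); that is, both f^{rhobar_{p}}_{p} and its first derivative are admissible, and f^{rhobar_{p}}_{p} has Hilbert polynomial p(z) and regularity rhobar_{p}. -/

import Mathlib

open scoped Classical

noncomputable section

/-! ## Binomial expansions and the Macaulay operations `(a_t)^+_+` and `(a_t)^-_-` -/

/-- The largest `k` such that `C(k,t) ≤ a` (top coefficient of the greedy binomial
expansion of `a` in base `t`). -/
def expTop (a t : ℕ) : ℕ := Nat.findGreatest (fun k => Nat.choose k t ≤ a) (a + t + 1)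

/-- `(a_t)^+_+` : if `a = C(k(t),t) + ... + C(k(j),j)` is the binomial expansion of `a`
in base `t`, then `plusPlus a t = C(k(t)+1,t+1) + ... + C(k(j)+1,j+1)`; it sends `0` to `0`. -/
def plusPlus : ℕ → ℕ → ℕ
  | _, 0 => 0
  | a, t + 1 =>
    if a = 0 then 0
    else Nat.choose (expTop a (t + 1) + 1) (t + 2) +
      plusPlus (a - Nat.choose (expTop a (t + 1)) (t + 1)) t

/-- `(a_t)^-_-` : if `a = C(k(t),t) + ... + C(k(j),j)` is the binomial expansion of `a`
in base `t`, then `minusMinus a t = C(k(t)-1,t-1) + ... + C(k(j)-1,j-1)`; it sends `0` to `0`. -/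
def minusMinus : ℕ → ℕ → ℕ
  | _, 0 => 0
  | a, t + 1 =>
    if a = 0 then 0
    else Nat.choose (expTop a (t + 1) - 1) t +
      minusMinus (a - Nat.choose (expTop a (t + 1)) (t + 1)) t

/-! ## Numerical functions -/

/-- A numerical function (modelled with values in `ℤ`) is *admissible* (an O-sequence) if it is
nonnegative, `H 0 = 1` and `H (t+1) ≤ (H(t)_t)^+_+` for every `t ≥ 1`. -/
def OSeq (H : ℕ → ℤ) : Prop :=
  (∀ t, 0 ≤ H t) ∧ H 0 = 1 ∧ ∀ t, 1 ≤ t → H (t + 1) ≤ (plusPlus (H t).toNat t : ℤ)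

/-- First derivative of a numerical function: `Δf(0) = 1`, `Δf(t) = f(t) - f(t-1)`. -/
def nderiv (f : ℕ → ℤ) : ℕ → ℤ
  | 0 => 1
  | t + 1 => f (t + 1) - f t

/-- Integral of a numerical function: `Σg(0) = 1`, `Σg(t) = Σg(t-1) + g(t)`. -/
def ninteg (g : ℕ → ℤ) : ℕ → ℤ
  | 0 => 1
  | t + 1 => ninteg g t + g (t + 1)

/-! ## Admissible Hilbert polynomials in Gotzmann form -/

/-- The integer-valued binomial coefficient `C(a,k)` for `a : ℤ`, agreeing with the
polynomial binomial coefficient `a(a-1)⋯(a-k+1)/k!`. -/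
def zchoose (a : ℤ) (k : ℕ) : ℤ :=
  if 0 ≤ a then (a.toNat.choose k : ℤ)
  else (-1) ^ k * (((k : ℤ) - 1 - a).toNat.choose k : ℤ)

/-- An admissible Hilbert polynomial, recorded through its Gotzmann form
`p(z) = C(z+k₁,k₁) + C(z+k₂-1,k₂) + ... + C(z+k_r-(r-1),k_r)` with `k₁ ≥ k₂ ≥ ... ≥ k_r ≥ 0`. -/
structure GotzmannPoly where
  ks : List ℕ
  sorted : ks.Pairwise (· ≥ ·)

namespace GotzmannPoly

/-- The Gotzmann number `r` of `p`. -/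
def r (p : GotzmannPoly) : ℕ := p.ks.length

/-- The degree of `p`, namely `k₁`. -/
def degree (p : GotzmannPoly) : ℕ := p.ks.headD 0

/-- Evaluation of `p` at an integer. -/
def eval (p : GotzmannPoly) (z : ℤ) : ℤ :=
  ∑ i ∈ Finset.range p.r, zchoose (z + (p.ks.getD i 0 : ℤ) - i) (p.ks.getD i 0)

/-- The first difference `Δp(z) = p(z) - p(z-1)`, in Gotzmann form. -/
def delta (p : GotzmannPoly) : GotzmannPoly where
  ks := (p.ks.filter fun k => 1 ≤ k).map fun k => k - 1
  sorted := by
    refine List.Pairwise.map _ (fun {a b} h => Nat.sub_le_sub_right h 1) ?_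
    exact p.sorted.filter _

/-- Iterated first difference `Δ^i p`. -/
def deltaIter (p : GotzmannPoly) (i : ℕ) : GotzmannPoly := delta^[i] p

/-- The polynomial `p(z) + c`, in Gotzmann form. -/
def addConst (p : GotzmannPoly) (c : ℕ) : GotzmannPoly where
  ks := p.ks ++ List.replicate c 0
  sorted := by
    rw [List.pairwise_append]
    refine ⟨p.sorted, ?_, ?_⟩
    · exact List.pairwise_replicate.2 (Or.inr le_rfl)
    · intro a _ b hb
      rw [List.eq_of_mem_replicate hb]
      exact Nat.zero_le a

end GotzmannPoly

/-- The set `Π_p = {1 ≤ t ≤ r : (p(t+h)_{t+h})^+_+ ≥ p(t+h+1) ≥ 1 for all h ≥ 0}`. -/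
def PiSet (p : GotzmannPoly) : Set ℕ :=
  {t | 1 ≤ t ∧ t ≤ p.r ∧ ∀ h : ℕ,
      p.eval ((t : ℤ) + (h : ℤ) + 1) ≤ (plusPlus (p.eval ((t : ℤ) + (h : ℤ))).toNat (t + h) : ℤ) ∧
      1 ≤ p.eval ((t : ℤ) + (h : ℤ) + 1)}

/-- `ρ_p`: `0` if `min Π_p = 1` and `p(0) = 1`, and `min Π_p` otherwise. -/
def rhoP (p : GotzmannPoly) : ℕ :=
  if sInf (PiSet p) = 1 ∧ p.eval 0 = 1 then 0 else sInf (PiSet p)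

/-- The minimal function `f^ρ_p` : `f(t) = p(t)` for `t ≥ ρ` and
`f(t) = ((f(t+1))_{t+1})^-_-` for `t < ρ`. -/
def fmin (p : GotzmannPoly) (ρ : ℕ) (t : ℕ) : ℤ :=
  if h : ρ ≤ t then p.eval (t : ℤ)
  else (minusMinus (fmin p ρ (t + 1)).toNat (t + 1) : ℤ)
termination_by ρ - t
decreasing_by omega

/-- The function `g^ρ_p` : `g(t) = p(t)` for `t ≥ ρ`, `g(ρ-1) = p(ρ-1) + 1` and
`g(t) = ((g(t+1))_{t+1})^-_-` for `t < ρ-1`. -/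
def gmin (p : GotzmannPoly) (ρ : ℕ) (t : ℕ) : ℤ :=
  if h : ρ ≤ t then p.eval (t : ℤ)
  else if t = ρ - 1 then p.eval (t : ℤ) + 1
  else (minusMinus (gmin p ρ (t + 1)).toNat (t + 1) : ℤ)
termination_by ρ - t
decreasing_by omega

/-- `H` has regularity `ρ` (with respect to the Hilbert polynomial `p`): `ρ` is the least
integer such that `H(t) = p(t)` for all `t ≥ ρ`. -/
def IsRegOf (p : GotzmannPoly) (H : ℕ → ℤ) (ρ : ℕ) : Prop :=
  (∀ t : ℕ, ρ ≤ t → H t = p.eval (t : ℤ)) ∧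
  ∀ ρ' : ℕ, (∀ t : ℕ, ρ' ≤ t → H t = p.eval (t : ℤ)) → ρ ≤ ρ'

/-- `H` has Hilbert polynomial `p`, i.e. eventually agrees with `p`. -/
def HasHP (p : GotzmannPoly) (H : ℕ → ℤ) : Prop :=
  ∃ N : ℕ, ∀ t : ℕ, N ≤ t → H t = p.eval (t : ℤ)

/-- `F(p,ρ)`: the set of Hilbert functions of closed projective subschemes (i.e. numerical
functions which are admissible together with their first derivative) with Hilbert
polynomial `p` and regularity `ρ`. -/
def Fset (p : GotzmannPoly) (ρ : ℕ) : Set (ℕ → ℤ) :=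
  {H | OSeq H ∧ OSeq (nderiv H) ∧ IsRegOf p H ρ}

/-- `ρ̄_p`: the minimal `ρ` such that `F(p,ρ)` is non-empty. -/
def rhobar (p : GotzmannPoly) : ℕ := sInf {ρ | (Fset p ρ).Nonempty}

/-! ## Monomial ideals in `K[x₀,…,xₙ]` (combinatorial model) -/

/-- Monomials of `K[x₀,…,xₙ]`, as exponent vectors. -/
abbrev Mon (n : ℕ) := Fin (n + 1) → ℕ

/-- Degree of a monomial. -/
def mdeg {n : ℕ} (m : Mon n) : ℕ := ∑ i, m i

/-- `T_t`, the set of terms of degree `t`. -/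
def Tset (n t : ℕ) : Set (Mon n) := {m | mdeg m = t}

/-- A set of monomials closed under multiplication by arbitrary monomials (a monomial ideal). -/
def MonIdeal {n : ℕ} (J : Set (Mon n)) : Prop :=
  ∀ m ∈ J, ∀ m' : Mon n, m + m' ∈ J

/-- The elementary Borel move sending `x^m` to `x_i · x^m / x_j`. -/
def borelStep {n : ℕ} (m : Mon n) (j i : Fin (n + 1)) : Mon n :=
  fun l => if l = j then m l - 1 else if l = i then m l + 1 else m l

/-- One elementary Borel move `x_j ↦ x_i` with `j < i`. -/
def borelMove {n : ℕ} (a b : Mon n) : Prop :=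
  ∃ j i : Fin (n + 1), j < i ∧ 1 ≤ a j ∧ b = borelStep a j i

/-- The Borel (partial) order `≤_B` on monomials. -/
def borelLE {n : ℕ} : Mon n → Mon n → Prop := Relation.ReflTransGen borelMove

/-- A strongly stable (Borel) monomial ideal. -/
def StronglyStable {n : ℕ} (J : Set (Mon n)) : Prop :=
  MonIdeal J ∧ ∀ m ∈ J, ∀ j i : Fin (n + 1), j < i → 1 ≤ m j → borelStep m j i ∈ J

/-- A Borel set in `T_t`: a set of degree-`t` monomials closed upwards under `≤_B`. -/
def IsBorelSet {n : ℕ} (t : ℕ) (B : Set (Mon n)) : Prop :=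
  B ⊆ Tset n t ∧ ∀ a ∈ B, ∀ b : Mon n, borelLE a b → b ∈ B

/-- Saturation of a monomial ideal:
`J^sat = {m : for every i there is k with x_i^k · m ∈ J}`. -/
def monSat {n : ℕ} (J : Set (Mon n)) : Set (Mon n) :=
  {m | ∀ i : Fin (n + 1), ∃ k : ℕ, (fun l => if l = i then m l + k else m l) ∈ J}

/-- The monomial ideal generated by a set of monomials. -/
def genIdeal {n : ℕ} (B : Set (Mon n)) : Set (Mon n) :=
  {m | ∃ b ∈ B, ∃ c : Mon n, m = b + c}

/-- The Hilbert function of `S/J` for a monomial ideal `J`: the number of degree-`t`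
monomials outside `J`. -/
def hilb {n : ℕ} (J : Set (Mon n)) (t : ℕ) : ℕ :=
  Set.ncard {m : Mon n | mdeg m = t ∧ m ∉ J}

/-- `m / x_i` as an exponent vector. -/
def shrinkAt {n : ℕ} (m : Mon n) (i : Fin (n + 1)) : Mon n :=
  fun l => if l = i then m l - 1 else m l

/-- `m` is a minimal (monomial) generator of the monomial ideal `J`. -/
def IsMinGen {n : ℕ} (J : Set (Mon n)) (m : Mon n) : Prop :=
  m ∈ J ∧ ∀ i : Fin (n + 1), 1 ≤ m i → shrinkAt m i ∉ J

/-- The Castelnuovo–Mumford regularity of a strongly stable ideal: the maximal degree of a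
minimal monomial generator. -/
def monReg {n : ℕ} (J : Set (Mon n)) : ℕ :=
  sSup {d | ∃ m : Mon n, IsMinGen J m ∧ mdeg m = d}

/-- `m_u`: the minimal Castelnuovo–Mumford regularity of a closed projective subscheme with
Hilbert function `u`, i.e. the minimum of `reg J` over all `n` and all saturated strongly
stable ideals `J ⊆ K[x₀,…,xₙ]` with `H_{S/J} = u`. -/
def mReg (u : ℕ → ℤ) : ℕ :=
  sInf {r | ∃ (n : ℕ) (J : Set (Mon n)), StronglyStable J ∧ monSat J = J ∧
      (∀ t : ℕ, (hilb J t : ℤ) = u t) ∧ monReg J = r}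

/-- `M(p,ρ) = {m_u : u ∈ F(p,ρ)}`. -/
def Mset (p : GotzmannPoly) (ρ : ℕ) : Set ℕ := {r | ∃ u ∈ Fset p ρ, mReg u = r}

/-- `m^ρ_p = min M(p,ρ)`. -/
def mRho (p : GotzmannPoly) (ρ : ℕ) : ℕ := sInf (Mset p ρ)

/-- `m_p`: the minimal Castelnuovo–Mumford regularity of schemes with Hilbert polynomial `p`. -/
def mP (p : GotzmannPoly) : ℕ := sInf {r | ∃ ρ : ℕ, ∃ u ∈ Fset p ρ, mReg u = r}

/-! ## Lex segments and growth-height-lexicographic Borel sets -/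

/-- `a` is smaller than `b` in the deglex order (for monomials of the same degree):
`a k < b k` where `k` is the largest index where they differ. -/
def deglexLT {n : ℕ} (a b : Mon n) : Prop :=
  ∃ k : Fin (n + 1), a k < b k ∧ ∀ l : Fin (n + 1), k < l → a l = b l

/-- A lex-segment of `T_t`: a set of degree-`t` monomials consisting of the highest terms
with respect to deglex. -/
def IsLexSeg {n : ℕ} (t : ℕ) (L : Set (Mon n)) : Prop :=
  L ⊆ Tset n t ∧ ∀ a ∈ L, ∀ b ∈ Tset n t, deglexLT a b → b ∈ L

/-- A lex-segment in `A ⊆ T_t`: the intersection of a lex-segment of `T_t` with `A`. -/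
def LexSegIn {n : ℕ} (t : ℕ) (A S : Set (Mon n)) : Prop :=
  ∃ L : Set (Mon n), IsLexSeg t L ∧ S = L ∩ A

/-- The growth class `B^{(i)} = {m ∈ B : min(m) = i}`. -/
def growthClass {n : ℕ} (B : Set (Mon n)) (i : Fin (n + 1)) : Set (Mon n) :=
  {m | m ∈ B ∧ 1 ≤ m i ∧ ∀ j : Fin (n + 1), j < i → m j = 0}

/-- The height class `B(i) = {m ∈ B : the exponent of x₀ in m is i}`. -/
def heightClass {n : ℕ} (B : Set (Mon n)) (i : ℕ) : Set (Mon n) :=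
  {m | m ∈ B ∧ m 0 = i}

/-- A Borel set `B ⊆ T_t` is growth-lexicographic if all its growth classes are lex-segments
in the corresponding growth classes of `T_t`. -/
def GrowthLex {n : ℕ} (t : ℕ) (B : Set (Mon n)) : Prop :=
  ∀ i : Fin (n + 1), LexSegIn t (growthClass (Tset n t) i) (growthClass B i)

/-- A Borel set `B ⊆ T_t` is growth-height-lexicographic if `B(0)` is growth-lexicographic
and `B(i)` is a lex-segment in `T_t(i)` for every `0 < i ≤ t`. -/
def GHLex {n : ℕ} (t : ℕ) (B : Set (Mon n)) : Prop :=
  GrowthLex t (heightClass B 0) ∧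
  ∀ i : ℕ, 0 < i → i ≤ t → LexSegIn t (heightClass (Tset n t) i) (heightClass B i)

end

/-! ### Greedy binomial expansions -/

lemma lt_choose_add_self (a t : ℕ) : a < (a + (t + 1)).choose (t + 1) := by
  induction t with
  | zero => simp
  | succ t ih =>
    have := Nat.choose_succ_succ (a + (t + 1)) (t + 1)
    simp only [Nat.succ_eq_add_one] at this
    rw [← add_assoc a (t + 1) 1, this]
    omega

lemma expTop_spec (a t : ℕ) :
    (expTop a (t + 1)).choose (t + 1) ≤ a ∧ a < (expTop a (t + 1) + 1).choose (t + 1) := by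
  have h1 : (expTop a (t + 1)).choose (t + 1) ≤ a := by
    unfold expTop
    exact Nat.findGreatest_spec (P := fun k => Nat.choose k (t + 1) ≤ a) (m := 0)
      (Nat.zero_le _) (by simp)
  refine ⟨h1, ?_⟩
  have hlt : expTop a (t + 1) < a + (t + 1) := by
    by_contra! h
    have := Nat.choose_le_choose (t + 1) h
    have := lt_choose_add_self a t
    omega
  by_contra! h
  exact Nat.findGreatest_is_greatest (P := fun k => Nat.choose k (t + 1) ≤ a)
    (n := a + (t + 1) + 1) (Nat.lt_succ_self (expTop a (t + 1)))
    (by simp only [Nat.succ_eq_add_one]; omega) h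

lemma expTop_eq {a t k : ℕ} (h1 : k.choose (t + 1) ≤ a) (h2 : a < (k + 1).choose (t + 1)) :
    expTop a (t + 1) = k := by
  obtain ⟨h3, h4⟩ := expTop_spec a t
  apply le_antisymm
  · by_contra! h
    have := Nat.choose_le_choose (t + 1) (Nat.succ_le_of_lt h)
    simp only [Nat.succ_eq_add_one] at this
    omega
  · by_contra! h
    have := Nat.choose_le_choose (t + 1) (Nat.succ_le_of_lt h)
    simp only [Nat.succ_eq_add_one] at this
    omega

lemma plusPlus_zero (t : ℕ) : plusPlus 0 t = 0 := by
  cases t <;> simp [plusPlus]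

lemma minusMinus_zero (t : ℕ) : minusMinus 0 t = 0 := by
  cases t <;> simp [minusMinus]

/-- Green's operation `(a_t)_-`: if `a = C(k(t),t) + ... + C(k(j),j)` is the binomial expansion
of `a` in base `t`, then `lowerMinus a t = C(k(t)-1,t) + ... + C(k(j)-1,j)`. -/
def lowerMinus : ℕ → ℕ → ℕ
  | _, 0 => 0
  | a, t + 1 =>
    if a = 0 then 0
    else Nat.choose (expTop a (t + 1) - 1) (t + 1) +
      lowerMinus (a - Nat.choose (expTop a (t + 1)) (t + 1)) t

lemma lowerMinus_zero (t : ℕ) : lowerMinus 0 t = 0 := by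
  cases t <;> simp [lowerMinus]

/-- Splitting off the leading term of the binomial expansion. -/
lemma exists_leading_term {a : ℕ} (ha : a ≠ 0) (t : ℕ) :
    ∃ m b, t ≤ m ∧ a = (m + 1).choose (t + 1) + b ∧ b < (m + 1).choose t ∧
      plusPlus a (t + 1) = (m + 2).choose (t + 2) + plusPlus b t ∧
      minusMinus a (t + 1) = m.choose t + minusMinus b t ∧
      lowerMinus a (t + 1) = m.choose (t + 1) + lowerMinus b t := by
  obtain ⟨h1, h2⟩ := expTop_spec a t
  obtain ⟨m, hm⟩ : ∃ m, expTop a (t + 1) = m + 1 := by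
    refine Nat.exists_eq_succ_of_ne_zero fun h => ?_
    rw [h] at h2
    have := Nat.choose_le_choose (t + 1) (show 0 + 1 ≤ t + 1 by omega)
    rw [Nat.choose_self] at this
    omega
  rw [hm] at h1 h2
  have hp := Nat.choose_succ_succ (m + 1) t
  simp only [Nat.succ_eq_add_one] at hp
  refine ⟨m, a - (m + 1).choose (t + 1), ?_, by omega, by omega, ?_, ?_, ?_⟩
  · by_contra! h
    have := Nat.choose_le_choose (t + 1) (show m + 1 + 1 ≤ t + 1 by omega)
    rw [Nat.choose_self] at this
    omega
  · simp [plusPlus, ha, hm]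
  · simp [minusMinus, ha, hm]
  · simp [lowerMinus, ha, hm]

lemma plusPlus_choose_add {m t b : ℕ} (hm : t ≤ m) (hb : b < (m + 1).choose t) :
    plusPlus ((m + 1).choose (t + 1) + b) (t + 1) = (m + 2).choose (t + 2) + plusPlus b t := by
  have hpos : 0 < (m + 1).choose (t + 1) := Nat.choose_pos (by omega)
  have hp := Nat.choose_succ_succ (m + 1) t
  simp only [Nat.succ_eq_add_one] at hp
  have he : expTop ((m + 1).choose (t + 1) + b) (t + 1) = m + 1 :=
    expTop_eq (by omega) (by omega)
  have h0 : (m + 1).choose (t + 1) + b ≠ 0 := by omega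
  simp only [plusPlus, he, if_neg h0, Nat.add_sub_cancel_left]

lemma minusMinus_add_lowerMinus (a t : ℕ) (h : t = 0 → a = 0) :
    minusMinus a t + lowerMinus a t = a := by
  induction t generalizing a with
  | zero => simp [minusMinus, lowerMinus, h rfl]
  | succ t ih =>
    rcases eq_or_ne a 0 with rfl | ha
    · simp [minusMinus_zero, lowerMinus_zero]
    obtain ⟨m, b, -, hab, hb, -, h2, h3⟩ := exists_leading_term ha t
    have := ih b (by rintro rfl; simpa using hb)
    have hp := Nat.choose_succ_succ m t
    simp only [Nat.succ_eq_add_one] at hp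
    omega

lemma lowerMinus_lt {a m s : ℕ} (hm : s ≤ m) (ha : a < (m + 1).choose s) :
    lowerMinus a s < m.choose s := by
  induction s generalizing a m with
  | zero => simp [lowerMinus]
  | succ s ih =>
    have hpos : 0 < m.choose (s + 1) := Nat.choose_pos hm
    rcases eq_or_ne a 0 with rfl | h0
    · simpa [lowerMinus_zero] using hpos
    obtain ⟨n, b, hn, hab, hb, -, -, h3⟩ := exists_leading_term h0 s
    have := ih hn hb
    have hp := Nat.choose_succ_succ n s
    simp only [Nat.succ_eq_add_one] at hp
    have hnm : n + 1 ≤ m := by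
      by_contra! h
      have := Nat.choose_le_choose (s + 1) (show m + 1 ≤ n + 1 by omega)
      omega
    have := Nat.choose_le_choose (s + 1) hnm
    omega

lemma minusMinus_le {a m s : ℕ} (ha : a < (m + 1).choose (s + 1)) :
    minusMinus a (s + 1) ≤ m.choose s := by
  induction s generalizing a m with
  | zero =>
    rcases eq_or_ne a 0 with rfl | h0
    · simp [minusMinus_zero]
    · simp [minusMinus, h0]
  | succ s ih =>
    rcases eq_or_ne a 0 with rfl | h0
    · simp [minusMinus_zero]
    obtain ⟨n, b, hn, hab, hb, -, h2, -⟩ := exists_leading_term h0 (s + 1)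
    have := ih hb
    have hp := Nat.choose_succ_succ n s
    simp only [Nat.succ_eq_add_one] at hp
    have hnm : n + 1 ≤ m := by
      by_contra! h
      have := Nat.choose_le_choose (s + 1 + 1) (show m + 1 ≤ n + 1 by omega)
      omega
    have := Nat.choose_le_choose (s + 1) hnm
    omega

lemma minusMinus_pos {a : ℕ} (ha : a ≠ 0) (t : ℕ) : 0 < minusMinus a (t + 1) := by
  obtain ⟨m, b, hm, -, -, -, h2, -⟩ := exists_leading_term ha t
  have := Nat.choose_pos hm
  omega

lemma minusMinus_one {a : ℕ} (ha : a ≠ 0) : minusMinus a 1 = 1 := by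
  simp [minusMinus, ha]

/-- `(a_t)^+_+ = a + (((a_t)_-)_t)^+_+`. -/
lemma plusPlus_eq_add_plusPlus_lowerMinus (a t : ℕ) (h : t = 0 → a = 0) :
    plusPlus a t = a + plusPlus (lowerMinus a t) t := by
  induction t generalizing a with
  | zero => simp [plusPlus, h rfl]
  | succ t ih =>
    rcases eq_or_ne a 0 with rfl | ha
    · simp [plusPlus_zero, lowerMinus_zero]
    obtain ⟨m, b, hm, hab, hb, h1, -, h3⟩ := exists_leading_term ha t
    have hi := ih b (by rintro rfl; simpa using hb)
    have hlt := lowerMinus_lt hm hb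
    have hp := Nat.choose_succ_succ (m + 1) (t + 1)
    simp only [Nat.succ_eq_add_one] at hp
    rw [h3, h1]
    rcases hm.eq_or_lt with rfl | hm
    · rw [Nat.choose_self, Nat.lt_one_iff] at hlt
      rw [hlt, plusPlus_zero] at hi
      rw [Nat.choose_succ_self, hlt, plusPlus_zero, hi]
      have := Nat.choose_succ_self (t + 1)
      simp only [Nat.succ_eq_add_one] at this
      simp only [add_assoc, Nat.reduceAdd] at *
      omega
    · obtain ⟨n, rfl⟩ : ∃ n, m = n + 1 := ⟨m - 1, by omega⟩
      rw [plusPlus_choose_add (by omega) hlt]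
      simp only [add_assoc, Nat.reduceAdd] at *
      omega

/-- `a ≤ (((a_{t+1})^-_-)_t)^+_+` for `t ≥ 1`. -/
lemma le_plusPlus_minusMinus (a t : ℕ) :
    a ≤ plusPlus (minusMinus a (t + 2)) (t + 1) := by
  induction t generalizing a with
  | zero =>
    rcases eq_or_ne a 0 with rfl | ha
    · simp
    obtain ⟨m, b, hm, hab, hb, -, h2, -⟩ := exists_leading_term ha 1
    have hle : minusMinus b 1 ≤ m.choose 0 := minusMinus_le hb
    obtain ⟨n, rfl⟩ : ∃ n, m = n + 1 := ⟨m - 1, by omega⟩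
    rcases hle.lt_or_eq with hlt | heq
    · have hb0 : b = 0 := by
        by_contra hb0
        have := minusMinus_pos hb0 0
        simp at hlt
        simp only [add_assoc, zero_add, Nat.reduceAdd] at *
        omega
      have := plusPlus_choose_add (m := n) (t := 0) (b := 0) (by omega) (by simp)
      simp only [zero_add, plusPlus_zero, add_zero] at this
      rw [h2, hb0, minusMinus_zero, add_zero, this]
      simp only [add_assoc, Nat.reduceAdd] at *
      omega
    · have := plusPlus_choose_add (m := n + 1) (t := 0) (b := 0) (by omega) (by simp)
      simp only [zero_add, plusPlus_zero, add_zero] at this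
      have hp := Nat.choose_succ_succ (n + 2) 1
      have hq := Nat.choose_succ_succ (n + 1) 0
      simp only [Nat.succ_eq_add_one, zero_add] at hp hq
      rw [h2, heq, show (n + 1).choose 1 + (n + 1).choose 0 = (n + 1 + 1).choose 1 by omega, this]
      simp only [add_assoc, Nat.reduceAdd] at *
      omega
  | succ t ih =>
    rcases eq_or_ne a 0 with rfl | ha
    · simp
    obtain ⟨m, b, hm, hab, hb, -, h2, -⟩ := exists_leading_term ha (t + 2)
    have hle : minusMinus b (t + 2) ≤ m.choose (t + 1) := minusMinus_le hb
    obtain ⟨n, rfl⟩ : ∃ n, m = n + 1 := ⟨m - 1, by omega⟩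
    rcases hle.lt_or_eq with hlt | heq
    · have := plusPlus_choose_add (m := n) (t := t + 1) (by omega) hlt
      rw [h2, this]
      have := ih b
      simp only [add_assoc, Nat.reduceAdd] at *
      omega
    · have := plusPlus_choose_add (m := n + 1) (t := t + 1) (b := 0) (by omega)
        (Nat.choose_pos (by omega))
      simp only [plusPlus_zero, add_zero] at this
      have hp := Nat.choose_succ_succ (n + 2) (t + 2)
      have hq := Nat.choose_succ_succ (n + 1) (t + 1)
      simp only [Nat.succ_eq_add_one] at hp hq
      rw [h2, heq, show (n + 1).choose (t + 2) + (n + 1).choose (t + 1)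
        = (n + 1 + 1).choose (t + 1 + 1) by
          simp only [add_assoc, Nat.reduceAdd] at *
          omega, this]
      simp only [add_assoc, Nat.reduceAdd] at *
      omega

/-! ### Gotzmann polynomials -/

/-- The sum `C(t+k₁,t) + C(t-1+k₂,t-1) + ...`, which is the binomial expansion in base `t` of the
value at `t` of the polynomial with Gotzmann form `[k₁, k₂, ...]`. -/
def gotzmannSum : List ℕ → ℕ → ℕ
  | [], _ => 0
  | k :: l, t => (t + k).choose t + gotzmannSum l (t - 1)

lemma gotzmannSum_lt {l : List ℕ} (hl : l.Pairwise (· ≥ ·)) {k s : ℕ} (hk : ∀ x ∈ l, x ≤ k)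
    (hs : l.length ≤ s) : gotzmannSum l s < (s + 1 + k).choose s := by
  induction l generalizing k s with
  | nil => exact Nat.choose_pos (by omega)
  | cons x l ih =>
    obtain ⟨s, rfl⟩ : ∃ s', s = s' + 1 := ⟨s - 1, by simp at hs; omega⟩
    rw [List.pairwise_cons] at hl
    have h1 := ih hl.2 (k := x) (s := s) hl.1 (by simpa using hs)
    have hx : x ≤ k := hk x (by simp)
    have h2 := Nat.choose_le_choose (s + 1) (show s + 1 + x + 1 ≤ s + 1 + 1 + k by omega)
    have h3 := Nat.choose_succ_succ (s + 1 + x) s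
    simp only [Nat.succ_eq_add_one] at h3
    simp only [gotzmannSum, Nat.add_sub_cancel]
    omega

lemma plusPlus_gotzmannSum {l : List ℕ} (hl : l.Pairwise (· ≥ ·)) {t : ℕ} (ht : l.length ≤ t) :
    plusPlus (gotzmannSum l t) t = gotzmannSum l (t + 1) := by
  induction l generalizing t with
  | nil => simp [gotzmannSum, plusPlus_zero]
  | cons x l ih =>
    obtain ⟨t, rfl⟩ : ∃ s, t = s + 1 := ⟨t - 1, by simp at ht; omega⟩
    rw [List.pairwise_cons] at hl
    have hlen : l.length ≤ t := by simpa using ht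
    have h1 := gotzmannSum_lt hl.2 hl.1 hlen
    have h2 := plusPlus_choose_add (m := t + x) (t := t) (b := gotzmannSum l t) (by omega)
      (by convert h1 using 2; omega)
    simp only [gotzmannSum, Nat.add_sub_cancel]
    rw [show t + 1 + x = t + x + 1 by omega, h2, ih hl.2 hlen,
      show t + 1 + 1 + x = t + x + 2 by omega]

lemma gotzmannSum_pos {l : List ℕ} (hl : l ≠ []) (t : ℕ) : 0 < gotzmannSum l t := by
  cases l with
  | nil => exact absurd rfl hl
  | cons x l =>
    have : 0 < (t + x).choose t := Nat.choose_pos (by omega)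
    simp only [gotzmannSum]
    omega

lemma zchoose_of_nonneg {a : ℤ} (ha : 0 ≤ a) (k : ℕ) : zchoose a k = (a.toNat.choose k : ℤ) :=
  if_pos ha

lemma sum_zchoose_eq_gotzmannSum (l : List ℕ) (t : ℕ) (ht : l.length ≤ t) :
    ∑ i ∈ Finset.range l.length, zchoose ((t : ℤ) + (l.getD i 0 : ℤ) - i) (l.getD i 0)
      = gotzmannSum l t := by
  induction l generalizing t with
  | nil => simp [gotzmannSum]
  | cons x l ih =>
    obtain ⟨t, rfl⟩ : ∃ s, t = s + 1 := ⟨t - 1, by simp at ht; omega⟩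
    rw [List.length_cons, Finset.sum_range_succ']
    have := ih t (by simpa using ht)
    simp only [gotzmannSum, Nat.add_sub_cancel, Nat.cast_add, ← this]
    rw [add_comm]
    congr 1
    · simp only [List.getD_cons_zero]
      rw [zchoose_of_nonneg (by push_cast; omega)]
      rw [show ((t : ℤ) + ((1 : ℕ) : ℤ) + (x : ℤ) - ((0 : ℕ) : ℤ)).toNat = t + 1 + x by omega,
        Nat.choose_symm_add]
    · refine Finset.sum_congr rfl fun i _ => ?_
      simp only [List.getD_cons_succ]
      congr 1
      push_cast
      ring

namespace GotzmannPoly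

lemma eval_eq_gotzmannSum (p : GotzmannPoly) {t : ℕ} (ht : p.r ≤ t) :
    p.eval t = gotzmannSum p.ks t :=
  sum_zchoose_eq_gotzmannSum p.ks t ht

lemma one_le_eval (p : GotzmannPoly) (hr : 1 ≤ p.r) {t : ℕ} (ht : p.r ≤ t) : 1 ≤ p.eval t := by
  rw [p.eval_eq_gotzmannSum ht]
  have : p.ks ≠ [] := by
    intro h
    simp [r, h] at hr
  exact_mod_cast gotzmannSum_pos this t

lemma r_mem_PiSet (p : GotzmannPoly) (hr : 1 ≤ p.r) : p.r ∈ PiSet p := by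
  refine ⟨hr, le_rfl, fun h => ⟨?_, ?_⟩⟩
  · have h1 := p.eval_eq_gotzmannSum (t := p.r + h) (by omega)
    have h2 := p.eval_eq_gotzmannSum (t := p.r + h + 1) (by omega)
    push_cast at h1 h2
    rw [h1, h2, Int.toNat_natCast, plusPlus_gotzmannSum p.sorted (by simp [r])]
  · exact_mod_cast p.one_le_eval hr (t := p.r + h + 1) (by omega)

lemma eval_of_r_eq_zero (p : GotzmannPoly) (hr : p.r = 0) (z : ℤ) : p.eval z = 0 := by
  simp [eval, hr]

end GotzmannPoly

lemma zchoose_zero_right (a : ℤ) : zchoose a 0 = 1 := by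
  simp [zchoose]

lemma zchoose_sub_zchoose (a : ℤ) (k : ℕ) :
    zchoose a (k + 1) - zchoose (a - 1) (k + 1) = zchoose (a - 1) k := by
  rcases lt_trichotomy a 0 with h | rfl | h
  · obtain ⟨b, rfl⟩ : ∃ b : ℕ, a = -(b : ℤ) - 1 := ⟨(-a - 1).toNat, by omega⟩
    unfold zchoose
    rw [if_neg (by omega), if_neg (by omega), if_neg (by omega),
      show (((k + 1 : ℕ) : ℤ) - 1 - (-(b : ℤ) - 1)).toNat = k + b + 1 by omega,
      show (((k + 1 : ℕ) : ℤ) - 1 - (-(b : ℤ) - 1 - 1)).toNat = k + b + 1 + 1 by omega,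
      show ((k : ℤ) - 1 - (-(b : ℤ) - 1 - 1)).toNat = k + b + 1 by omega,
      Nat.choose_succ_succ (k + b + 1) k]
    push_cast
    ring
  · simp [zchoose, pow_succ]
  · obtain ⟨b, rfl⟩ : ∃ b : ℕ, a = (b : ℤ) + 1 := ⟨(a - 1).toNat, by omega⟩
    unfold zchoose
    rw [if_pos (by omega), if_pos (by omega), if_pos (by omega),
      show ((b : ℤ) + 1).toNat = b + 1 by omega, show ((b : ℤ) + 1 - 1).toNat = b by omega,
      Nat.choose_succ_succ]
    push_cast
    ring

lemma sum_zchoose_sub_sum_zchoose (l : List ℕ) (hl : l.Pairwise (· ≥ ·)) (z : ℤ) :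
    ∑ i ∈ Finset.range l.length, zchoose (z + (l.getD i 0 : ℤ) - i) (l.getD i 0)
      - ∑ i ∈ Finset.range l.length, zchoose (z - 1 + (l.getD i 0 : ℤ) - i) (l.getD i 0)
      = ∑ i ∈ Finset.range ((l.filter fun k => 1 ≤ k).map fun k => k - 1).length,
          zchoose (z + ((((l.filter fun k => 1 ≤ k).map fun k => k - 1).getD i 0 : ℕ) : ℤ) - i)
            (((l.filter fun k => 1 ≤ k).map fun k => k - 1).getD i 0) := by
  induction l generalizing z with
  | nil => simp
  | cons x l ih =>
    rw [List.pairwise_cons] at hl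
    have := ih hl.2 (z - 1)
    have hstep : ∀ (l : List ℕ) (w : ℤ) (i : ℕ), w + (l.getD i 0 : ℤ) - ((i + 1 : ℕ) : ℤ)
        = w - 1 + (l.getD i 0 : ℤ) - i := fun l w i => by push_cast; ring
    cases x with
    | zero =>
      have hf : (0 :: l).filter (fun k => 1 ≤ k) = [] := by
        rw [List.filter_eq_nil_iff]
        intro a ha
        rcases List.mem_cons.1 ha with rfl | ha
        · simp
        · simpa using hl.1 a ha
      have hf' : l.filter (fun k => 1 ≤ k) = [] := by
        rw [List.filter_eq_nil_iff]
        intro a ha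
        simpa using hl.1 a ha
      rw [hf'] at this
      rw [hf]
      simp only [List.length_cons, Finset.sum_range_succ', List.getD_cons_zero,
        List.getD_cons_succ, hstep, zchoose_zero_right]
      simpa using this
    | succ x =>
      have hf : ((x + 1) :: l).filter (fun k => 1 ≤ k) = (x + 1) :: l.filter (fun k => 1 ≤ k) := by
        simp
      rw [hf]
      have hz := zchoose_sub_zchoose (z + (x + 1)) x
      simp only [List.map_cons, List.length_cons, Finset.sum_range_succ', List.getD_cons_zero,
        List.getD_cons_succ, hstep, Nat.add_sub_cancel]
      rw [← this]
      push_cast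
      rw [show z + (x + 1) - 1 = z + x by ring] at hz
      rw [show z - 1 + ((x : ℤ) + 1) - 0 = z + x by ring, sub_zero, sub_zero, ← hz]
      ring

lemma GotzmannPoly.eval_delta (p : GotzmannPoly) (z : ℤ) :
    p.delta.eval z = p.eval z - p.eval (z - 1) :=
  (sum_zchoose_sub_sum_zchoose p.ks p.sorted z).symm

/-! ### The number `ρ_p` -/

lemma rhoP_le_sInf (p : GotzmannPoly) : rhoP p ≤ sInf (PiSet p) := by
  unfold rhoP
  split_ifs <;> omega

lemma rhoP_of_r_eq_zero (p : GotzmannPoly) (hr : p.r = 0) : rhoP p = 0 := by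
  have : PiSet p = ∅ := by
    ext t
    simp only [PiSet, Set.mem_ofPred_eq, Set.mem_empty_iff_false, iff_false]
    rintro ⟨h1, h2, -⟩
    omega
  have h := rhoP_le_sInf p
  rw [this, Nat.sInf_empty] at h
  omega

lemma OSeq.eq_zero_of_le {H : ℕ → ℤ} (hH : OSeq H) {t s : ℕ} (ht : 1 ≤ t) (h0 : H t = 0)
    (hts : t ≤ s) : H s = 0 := by
  induction s, hts using Nat.le_induction with
  | base => exact h0
  | succ s hs ih =>
    have h1 := hH.2.2 s (by omega)
    rw [ih, Int.toNat_zero, plusPlus_zero] at h1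
    exact le_antisymm h1 (hH.1 _)

/-- An O-sequence agreeing with `q` from `ρ` on forces `ρ_q ≤ ρ`. -/
lemma rhoP_le_of_OSeq {q : GotzmannPoly} {G : ℕ → ℤ} (hG : OSeq G) {ρ : ℕ}
    (hρ : ∀ t : ℕ, ρ ≤ t → G t = q.eval t) : rhoP q ≤ ρ := by
  rcases Nat.eq_zero_or_pos q.r with hr | hr
  · simp [rhoP_of_r_eq_zero q hr]
  have hpos : ∀ t, 1 ≤ t → 1 ≤ G t := by
    intro t ht
    by_contra! h
    have h0 : G t = 0 := le_antisymm (by omega) (hG.1 t)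
    have h1 := hG.eq_zero_of_le ht h0 (s := t + ρ + q.r) (by omega)
    have h2 := q.one_le_eval hr (t := t + ρ + q.r) (by omega)
    rw [← hρ _ (by omega)] at h2
    omega
  have hmem : ∀ s, 1 ≤ s → s ≤ q.r → ρ ≤ s → s ∈ PiSet q := by
    intro s h1 h2 h3
    refine ⟨h1, h2, fun h => ?_⟩
    have e1 := hρ (s + h) (by omega)
    have e2 := hρ (s + h + 1) (by omega)
    push_cast at e1 e2
    rw [← e1, ← e2]
    exact ⟨hG.2.2 _ (by omega), hpos _ (by omega)⟩
  rcases Nat.eq_zero_or_pos ρ with rfl | hρ1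
  · have h1 := Nat.sInf_le (hmem 1 le_rfl hr (by omega))
    have h2 := (Nat.sInf_mem ⟨_, q.r_mem_PiSet hr⟩).1
    have h3 : q.eval 0 = 1 := by
      have := hρ 0 le_rfl
      rw [hG.2.1] at this
      exact_mod_cast this.symm
    simp [rhoP, h3, le_antisymm h1 h2]
  · refine (rhoP_le_sInf q).trans ?_
    rcases le_total ρ q.r with h | h
    · exact Nat.sInf_le (hmem ρ hρ1 h le_rfl)
    · exact (Nat.sInf_le (q.r_mem_PiSet hr)).trans h

lemma eval_zero_of_rhoP_eq_zero {q : GotzmannPoly} (hr : 1 ≤ q.r) (h : rhoP q = 0) :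
    q.eval 0 = 1 := by
  have h2 := (Nat.sInf_mem ⟨_, q.r_mem_PiSet hr⟩).1
  unfold rhoP at h
  split_ifs at h with hc
  · exact hc.2
  · omega

lemma eval_succ_of_rhoP_le {q : GotzmannPoly} (hr : 1 ≤ q.r) {t : ℕ} (ht : 1 ≤ t)
    (h : rhoP q ≤ t) :
    q.eval ((t + 1 : ℕ) : ℤ) ≤ (plusPlus (q.eval t).toNat t : ℤ) ∧
      1 ≤ q.eval ((t + 1 : ℕ) : ℤ) := by
  obtain ⟨h1, -, h3⟩ := Nat.sInf_mem ⟨_, q.r_mem_PiSet hr⟩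
  have hle : sInf (PiSet q) ≤ t := by
    unfold rhoP at h
    split_ifs at h with hc
    · omega
    · exact h
  obtain ⟨d, rfl⟩ := Nat.exists_eq_add_of_le hle
  exact_mod_cast h3 d

lemma one_le_eval_of_rhoP_le {q : GotzmannPoly} (hr : 1 ≤ q.r) {t : ℕ} (h : rhoP q ≤ t) :
    1 ≤ q.eval t := by
  rcases Nat.eq_zero_or_pos t with rfl | ht
  · exact (eval_zero_of_rhoP_eq_zero hr (by omega)).symm.le
  · obtain ⟨h1, h2⟩ := eval_succ_of_rhoP_le hr ht h
    by_contra! hc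
    rw [Int.toNat_of_nonpos (by omega), plusPlus_zero] at h1
    omega

/-! ### The minimal function -/

lemma fmin_of_le (p : GotzmannPoly) {ρ t : ℕ} (h : ρ ≤ t) : fmin p ρ t = p.eval t := by
  rw [fmin, dif_pos h]

lemma fmin_of_lt (p : GotzmannPoly) {ρ t : ℕ} (h : t < ρ) :
    fmin p ρ t = (minusMinus (fmin p ρ (t + 1)).toNat (t + 1) : ℤ) := by
  rw [fmin, dif_neg (by omega)]

lemma one_le_fmin {p : GotzmannPoly} (hr : 1 ≤ p.r) {ρ : ℕ} (hρ : rhoP p ≤ ρ) (t : ℕ) :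
    1 ≤ fmin p ρ t := by
  rcases le_total ρ t with h | h
  · rw [fmin_of_le p h]
    exact one_le_eval_of_rhoP_le hr (hρ.trans h)
  · induction h using Nat.decreasingInduction with
    | self =>
      rw [fmin_of_le p le_rfl]
      exact one_le_eval_of_rhoP_le hr hρ
    | of_succ t ht ih =>
      rw [fmin_of_lt p ht]
      exact_mod_cast minusMinus_pos (by omega) t

lemma OSeq_fmin {p : GotzmannPoly} (hr : 1 ≤ p.r) {ρ : ℕ} (hρ : rhoP p ≤ ρ) :
    OSeq (fmin p ρ) := by
  have hpos := one_le_fmin hr hρ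
  refine ⟨fun t => by linarith [hpos t], ?_, fun t ht => ?_⟩
  · rcases Nat.eq_zero_or_pos ρ with rfl | h
    · rw [fmin_of_le p le_rfl]
      exact eval_zero_of_rhoP_eq_zero hr (by omega)
    · have := hpos 1
      rw [fmin_of_lt p h, minusMinus_one (by rw [zero_add]; omega)]
      rfl
  · rcases le_or_gt ρ t with h | h
    · rw [fmin_of_le p h, fmin_of_le p (h.trans t.le_succ)]
      exact (eval_succ_of_rhoP_le hr ht (hρ.trans h)).1
    · obtain ⟨s, rfl⟩ : ∃ s, t = s + 1 := ⟨t - 1, by omega⟩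
      have h1 := le_plusPlus_minusMinus (fmin p ρ (s + 1 + 1)).toNat s
      have h2 := hpos (s + 1 + 1)
      rw [fmin_of_lt p h, Int.toNat_natCast]
      simp only [add_assoc, Nat.reduceAdd] at *
      omega

lemma OSeq_nderiv_fmin {p : GotzmannPoly} (hr : 1 ≤ p.r) {ρ : ℕ} (hρ : rhoP p ≤ ρ)
    (hρ' : rhoP p.delta ≤ ρ + 1) : OSeq (nderiv (fmin p ρ)) := by
  have hpos := one_le_fmin hr hρ
  have hO := OSeq_fmin hr hρ
  have hlow : ∀ t, t < ρ →
      nderiv (fmin p ρ) (t + 1) = (lowerMinus (fmin p ρ (t + 1)).toNat (t + 1) : ℤ) := by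
    intro t ht
    have h1 := minusMinus_add_lowerMinus (fmin p ρ (t + 1)).toNat (t + 1) (by simp)
    have h2 := hpos (t + 1)
    simp only [nderiv]
    rw [fmin_of_lt p ht]
    omega
  have hhigh : ∀ t, ρ ≤ t →
      nderiv (fmin p ρ) (t + 1) = p.delta.eval ((t + 1 : ℕ) : ℤ) := by
    intro t ht
    simp only [nderiv]
    rw [fmin_of_le p ht, fmin_of_le p (ht.trans t.le_succ), p.eval_delta]
    push_cast
    simp
  refine ⟨fun t => ?_, rfl, fun t ht => ?_⟩
  · cases t with
    | zero => simp [nderiv]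
    | succ t =>
      rcases lt_or_ge t ρ with h | h
      · rw [hlow t h]
        exact Int.natCast_nonneg _
      · rw [hhigh t h]
        rcases Nat.eq_zero_or_pos p.delta.r with hd | hd
        · rw [p.delta.eval_of_r_eq_zero hd]
        · exact zero_le_one.trans (one_le_eval_of_rhoP_le hd (by omega))
  · obtain ⟨s, rfl⟩ : ∃ s, t = s + 1 := ⟨t - 1, by omega⟩
    rcases lt_or_ge s ρ with h | h
    · rw [hlow s h, Int.toNat_natCast]
      have h1 := plusPlus_eq_add_plusPlus_lowerMinus (fmin p ρ (s + 1)).toNat (s + 1) (by simp)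
      have h2 := hO.2.2 (s + 1) ht
      have h3 := hpos (s + 1)
      simp only [nderiv]
      omega
    · rw [hhigh s h, hhigh (s + 1) (by omega)]
      rcases Nat.eq_zero_or_pos p.delta.r with hd | hd
      · rw [p.delta.eval_of_r_eq_zero hd]
        exact Int.natCast_nonneg _
      · exact (eval_succ_of_rhoP_le hd ht (by omega)).1

/-- If an O-sequence with admissible first derivative agrees with `p` from `ρ` on, then
`max {ρ_p, ρ_{Δp} - 1} ≤ ρ`. -/
lemma max_rhoP_le {p : GotzmannPoly} {H : ℕ → ℤ} (hH : OSeq H) (hH' : OSeq (nderiv H)) {ρ : ℕ}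
    (hρ : ∀ t : ℕ, ρ ≤ t → H t = p.eval t) : max (rhoP p) (rhoP p.delta - 1) ≤ ρ := by
  refine max_le (rhoP_le_of_OSeq hH hρ) (Nat.sub_le_of_le_add (rhoP_le_of_OSeq hH' fun t ht => ?_))
  obtain ⟨s, rfl⟩ : ∃ s, t = s + 1 := ⟨t - 1, by omega⟩
  simp only [nderiv]
  rw [hρ s (by omega), hρ (s + 1) (by omega), p.eval_delta]
  push_cast
  simp

/-- Theorem `th:first derivative` (i).
`ρ̄_p = max{ρ_p, ρ_{Δp} - 1}` and `f^{ρ̄_p}_p ∈ F(p, ρ̄_p)`, i.e. both `f^{ρ̄_p}_p` and its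
first derivative are admissible and `f^{ρ̄_p}_p` has Hilbert polynomial `p` and
regularity `ρ̄_p`. -/
theorem statement7 (p : GotzmannPoly) (hr : 1 < p.r) :
    rhobar p = max (rhoP p) (rhoP p.delta - 1) ∧
    fmin p (rhobar p) ∈ Fset p (rhobar p) := by
  set ρ := max (rhoP p) (rhoP p.delta - 1) with hρ
  have hO : OSeq (fmin p ρ) := OSeq_fmin hr.le (le_max_left _ _)
  have hO' : OSeq (nderiv (fmin p ρ)) :=
    OSeq_nderiv_fmin hr.le (le_max_left _ _) (Nat.le_add_of_sub_le (le_max_right _ _))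
  have hmem : fmin p ρ ∈ Fset p ρ :=
    ⟨hO, hO', fun t ht => fmin_of_le p ht, fun ρ' h => max_rhoP_le hO hO' h⟩
  have hbar : rhobar p = ρ := by
    refine le_antisymm (Nat.sInf_le ⟨_, hmem⟩) (le_csInf ⟨ρ, _, hmem⟩ ?_)
    rintro ρ' ⟨H, hH, hH', hreg, -⟩
    exact max_rhoP_le hH hH' hreg
  rw [hbar]
  exact ⟨rfl, hmem⟩
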